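/- arXiv:1604.08234 — 4 statements merged into one kernel-verified Lean document; each statement's English description precedes it below -/
import Mathlib

section
/- An energy function e : V → ℤ≥0 ∪ {∞} is equal to the minimal energy function e*_{G,w} of the energy game (G,w) if and only if the following three conditions hold: (1) for every node u ∈ V_A there exists an edge (u,v) ∈ E with e(u) + w(u,v) ≥ e(v); (2) for every node u ∈ V_B and every edge (u,v) ∈ E, e(u) + w(u,v) ≥ e(v); (3) for every energy function e' that satisfies conditions (1) and (2), e(v) ≤ e'(v) for every node v ∈ V. -/
/-!
Common definitions for energy games (Brim et al. style), following the paper's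
definitions: a game graph is a finite directed graph in which every node has
out-degree at least one, together with a partition of the nodes into Alice's
nodes `VA` and Bob's nodes (the complement of `VA`).  Strategies are positional.
For a fixed pair of strategies the play from a node `s` is the orbit of the
induced successor function, and the minimal sufficient energy at `s` is the
least initial energy that keeps the running energy nonnegative forever, i.e.
`⨆ i, (-(weight of the length-i prefix))⁺ ∈ ℕ∞`; this coincides with
`∞` when the reachable cycle is negative and with `max (0, -min_P w(P))`
(minimum over simple paths `P` from `s`) otherwise.
-/

open scoped BigOperators

universe u

structure GameGraph (V : Type u) [Fintype V] [DecidableEq V] where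
  E : Finset (V × V)
  VA : Finset V
  exists_succ : ∀ v : V, ∃ u : V, (v, u) ∈ E

namespace GameGraph

variable {V : Type u} [Fintype V] [DecidableEq V]

/-- Positional strategies of Alice: a choice of an out-edge at every node of Alice. -/
def AliceStrategy (G : GameGraph V) : Type u :=
  {σ : V → V // ∀ u ∈ G.VA, (u, σ u) ∈ G.E}

/-- Positional strategies of Bob: a choice of an out-edge at every node of Bob. -/
def BobStrategy (G : GameGraph V) : Type u :=
  {τ : V → V // ∀ u : V, u ∉ G.VA → (u, τ u) ∈ G.E}

/-- The successor function of `G(σ,τ)`, the graph in which every node keeps only the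
out-edge chosen by its owner's strategy. -/
def play (G : GameGraph V) (σ : G.AliceStrategy) (τ : G.BobStrategy) (v : V) : V :=
  if v ∈ G.VA then σ.1 v else τ.1 v

/-- Total weight of the length-`i` prefix of the unique path from `s` in the
functional graph with successor function `f`. -/
def prefixWeight (w : V → V → ℤ) (f : V → V) (s : V) (i : ℕ) : ℤ :=
  ∑ j ∈ Finset.range i, w (f^[j] s) (f^[j + 1] s)

/-- The minimal sufficient energy `e*_{G(σ,τ),w}(s)` at `s` for a fixed pair of
strategies with induced successor function `f`:  the least initial energy
(in `ℕ∞ = ℤ≥0 ∪ {∞}`) keeping the running energy nonnegative forever.  It is `∞`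
iff the unique cycle reachable from `s` is negative, and `max (0, -min_P w(P))`
(minimum over simple paths from `s`) otherwise. -/
noncomputable def stratEnergy (w : V → V → ℤ) (f : V → V) (s : V) : ℕ∞ :=
  ⨆ i : ℕ, ((-(prefixWeight w f s i)).toNat : ℕ∞)

/-- The minimal sufficient energy `e*_{G,w}(s) = min_σ max_τ e*_{G(σ,τ),w}(s)`. -/
noncomputable def minEnergy (G : GameGraph V) (w : V → V → ℤ) (s : V) : ℕ∞ :=
  ⨅ σ : G.AliceStrategy, ⨆ τ : G.BobStrategy, stratEnergy w (G.play σ τ) s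

/-- Alice wins at `s` iff the minimal sufficient energy at `s` is finite. -/
noncomputable def AliceWins (G : GameGraph V) (w : V → V → ℤ) (s : V) : Prop :=
  G.minEnergy w s ≠ ⊤

/-- The canonical embedding `ℕ∞ = ℤ≥0 ∪ {∞} → ℤ ∪ {∞}` (extended arithmetic:
`∞ + x = ∞`, `∞ ≥ x`). -/
def toZInf (x : ℕ∞) : WithTop ℤ :=
  if x = ⊤ then ⊤ else ((x.toNat : ℤ) : WithTop ℤ)

/-- `max (x - z, 0)` for `x : ℕ∞` and `z : ℤ`, with `∞ - z = ∞`. -/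
def esub (x : ℕ∞) (z : ℤ) : ℕ∞ :=
  if x = ⊤ then ⊤ else ((((x.toNat : ℤ) - z).toNat : ℕ) : ℕ∞)

/-- The successors of `u` in `G`. -/
def succs (G : GameGraph V) (u : V) : Finset V :=
  (G.E.filter (fun p => p.1 = u)).image Prod.snd

/-- The weight function with every weight rounded up to the nearest multiple of `B`:
`w_B(u,v) = ⌈w(u,v)/B⌉·B`. -/
def roundW (w : V → V → ℤ) (B : ℤ) : V → V → ℤ :=
  fun u v => ⌈(w u v : ℚ) / (B : ℚ)⌉ * B

/-- `W = max_{(u,v) ∈ E} |w(u,v)|`. -/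
def maxAbsW (G : GameGraph V) (w : V → V → ℤ) : ℕ :=
  G.E.sup (fun p => (w p.1 p.2).natAbs)

/-- A strategy `τ` of Bob is optimal if `e*_{G(σ,τ),w}(s) ≥ e*_{G,w}(s)` for every
node `s` and every strategy `σ` of Alice. -/
noncomputable def IsOptimalBob (G : GameGraph V) (w : V → V → ℤ) (τ : G.BobStrategy) : Prop :=
  ∀ (s : V) (σ : G.AliceStrategy), G.minEnergy w s ≤ stratEnergy w (G.play σ τ) s

/-- Total weight of the cycle of length `L` through `x` in the functional graph `f`. -/
def cycleWeight (w : V → V → ℤ) (f : V → V) (x : V) (L : ℕ) : ℤ :=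
  ∑ j ∈ Finset.range L, w (f^[j] x) (f^[j + 1] x)

/-- A node `s` has penalty at least `D ≥ 0` if there is an optimal strategy `τ*` of Bob
such that for every strategy `σ` of Alice the unique cycle `C` reachable from `s` in
`G(σ,τ*)` satisfies: if `w(C) < 0` then the average weight `w(C)/|C|` is at most `-D`.
(The cycle is described by any node `x` on it, reachable from `s`, together with its
minimal period `L`.) -/
noncomputable def HasPenaltyAtLeast (G : GameGraph V) (w : V → V → ℤ) (s : V) (D : ℝ) : Prop :=
  ∃ τ : G.BobStrategy, G.IsOptimalBob w τ ∧
    ∀ σ : G.AliceStrategy, ∀ x : V, (∃ i : ℕ, (G.play σ τ)^[i] s = x) →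
      ∀ L : ℕ, 0 < L → (G.play σ τ)^[L] x = x →
        (∀ k : ℕ, 0 < k → k < L → (G.play σ τ)^[k] x ≠ x) →
        cycleWeight w (G.play σ τ) x L < 0 →
        ((cycleWeight w (G.play σ τ) x L : ℝ) / (L : ℝ) ≤ -D)

end GameGraph

namespace GameGraph

variable {V : Type u} [Fintype V] [DecidableEq V]

/-- An energy function `e` satisfies the first two (local) conditions of the
minimal-energy characterization: (1) every node `u` of Alice has an out-edge `(u,v)`
with `e(u) + w(u,v) ≥ e(v)`; (2) at every node `u` of Bob, every out-edge `(u,v)`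
satisfies `e(u) + w(u,v) ≥ e(v)`.  The inequalities are taken in `ℤ ∪ {∞}`. -/
def SatLocal (G : GameGraph V) (w : V → V → ℤ) (e : V → ℕ∞) : Prop :=
  (∀ u ∈ G.VA, ∃ v : V, (u, v) ∈ G.E ∧
      toZInf (e v) ≤ toZInf (e u) + ((w u v : ℤ) : WithTop ℤ)) ∧
  (∀ u : V, u ∉ G.VA → ∀ v : V, (u, v) ∈ G.E →
      toZInf (e v) ≤ toZInf (e u) + ((w u v : ℤ) : WithTop ℤ))

theorem toZInf_le_add_iff (a b : ℕ∞) (z : ℤ) :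
    toZInf b ≤ toZInf a + (z : WithTop ℤ) ↔
      ∀ n : ℕ, a = n → ∃ m : ℕ, b ≤ m ∧ (m : ℤ) ≤ n + z := by
  induction a using ENat.recTopCoe with
  | top => simp [toZInf]
  | coe a =>
    induction b using ENat.recTopCoe with
    | top =>
      simp only [toZInf, if_true, ENat.natCast_ne_top, if_false, ENat.toNat_natCast,
        ← WithTop.coe_add, top_le_iff, WithTop.coe_ne_top, ENat.natCast_inj, false_iff]
      simp
    | coe b =>
      simp only [toZInf, ENat.natCast_ne_top, if_false, ENat.toNat_natCast,
        ← WithTop.coe_add, WithTop.coe_le_coe, ENat.natCast_inj, Nat.cast_le]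
      constructor
      · rintro h n rfl
        exact ⟨b, le_rfl, h⟩
      · intro h
        obtain ⟨m, hm, h⟩ := h a rfl
        omega

theorem prefixWeight_add {α : Type*} (w : α → α → ℤ) (f : α → α) (s : α) (i j : ℕ) :
    prefixWeight w f s (i + j) = prefixWeight w f s i + prefixWeight w f (f^[i] s) j := by
  simp only [prefixWeight, Finset.sum_range_add, ← Function.iterate_add_apply]
  congr 1
  refine Finset.sum_congr rfl fun k _ => ?_
  rw [add_comm i k, add_right_comm k i 1]

theorem prefixWeight_one {α : Type*} (w : α → α → ℤ) (f : α → α) (s : α) :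
    prefixWeight w f s 1 = w s (f s) := by
  simp [prefixWeight]

theorem prefixWeight_mul_of_periodic {α : Type*} (w : α → α → ℤ) (f : α → α) (s : α) {p : ℕ}
    (hp : f^[p] s = s) (n : ℕ) :
    prefixWeight w f s (p * n) = n * prefixWeight w f s p := by
  induction n with
  | zero => simp [prefixWeight]
  | succ n ih =>
    rw [mul_add_one, add_comm, prefixWeight_add, hp, ih]
    push_cast
    ring

theorem iterate_update_eq {α : Type*} [DecidableEq α] (f : α → α) {u v s : α} {i : ℕ}
    (h : ∀ j < i, f^[j] s ≠ u) : (Function.update f u v)^[i] s = f^[i] s := by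
  induction i with
  | zero => rfl
  | succ i ih =>
    rw [Function.iterate_succ_apply', Function.iterate_succ_apply',
      ih fun j hj => h j (by omega), Function.update_of_ne (h i (by omega))]

theorem prefixWeight_update_eq {α : Type*} [DecidableEq α]
    (w : α → α → ℤ) (f : α → α) {u v s : α} {i : ℕ}
    (h : ∀ j < i, f^[j] s ≠ u) :
    prefixWeight w (Function.update f u v) s i = prefixWeight w f s i := by
  refine Finset.sum_congr rfl fun j hj => ?_
  have hj := Finset.mem_range.1 hj
  rw [iterate_update_eq f fun k hk => h k (by omega),
    iterate_update_eq f fun k hk => h k (by omega)]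

/-- Redirecting `u` to `v` either extends a walk from `v` by the edge `(u, v)`, or closes a
cycle through that edge, which bounded energy at `u` forces to have nonnegative weight. -/
theorem neg_prefixWeight_le_add {α : Type*} [DecidableEq α]
    (w : α → α → ℤ) (f : α → α) (u v : α) (n : ℕ)
    (hf : ∀ i, -prefixWeight w f u i ≤ n)
    (hfu : ∀ i, -prefixWeight w (Function.update f u v) u i ≤ n) (i : ℕ) :
    -prefixWeight w f v i ≤ n + w u v := by
  have step (k : ℕ) (hk : ∀ j < k, f^[j] v ≠ u) :
      prefixWeight w (Function.update f u v) u (1 + k) = w u v + prefixWeight w f v k := by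
    rw [prefixWeight_add, prefixWeight_one, Function.iterate_one, Function.update_self,
      prefixWeight_update_eq w f hk]
  by_cases hvisit : ∃ k, k < i ∧ f^[k] v = u
  · classical
    obtain ⟨hki, hku⟩ := Nat.find_spec hvisit
    have hmin : ∀ j < Nat.find hvisit, f^[j] v ≠ u := fun j hj hju =>
      Nat.find_min hvisit hj ⟨hj.trans hki, hju⟩
    generalize Nat.find hvisit = k at hki hku hmin
    have hper : (Function.update f u v)^[1 + k] u = u := by
      rw [add_comm, Function.iterate_add_apply, Function.iterate_one, Function.update_self,
        iterate_update_eq f hmin, hku]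
    have hcycle : 0 ≤ w u v + prefixWeight w f v k := by
      by_contra! hneg
      have h := hfu ((1 + k) * (n + 1))
      rw [prefixWeight_mul_of_periodic w _ u hper, step k hmin] at h
      push_cast at h
      nlinarith
    obtain ⟨l, rfl⟩ := Nat.exists_eq_add_of_lt hki
    rw [add_assoc, prefixWeight_add, hku]
    linarith [hf (l + 1)]
  · push Not at hvisit
    linarith [hfu (1 + i), step i hvisit]

theorem stratEnergy_le_iff {α : Type*} (w : α → α → ℤ) (f : α → α) (s : α) (n : ℕ) :
    stratEnergy w f s ≤ n ↔ ∀ i, -prefixWeight w f s i ≤ n := by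
  simp only [stratEnergy, iSup_le_iff, Nat.cast_le, Int.toNat_le]

instance (G : GameGraph V) : Nonempty G.AliceStrategy := by
  choose f hf using G.exists_succ
  exact ⟨⟨f, fun u _ => hf u⟩⟩

instance (G : GameGraph V) : Nonempty G.BobStrategy := by
  choose f hf using G.exists_succ
  exact ⟨⟨f, fun u _ => hf u⟩⟩

/-- Bob can redirect the play at `u` along any edge compatible with Alice's strategy. -/
theorem exists_play_eq_update (G : GameGraph V) (σ : G.AliceStrategy) (τ : G.BobStrategy)
    {u v : V} (hA : u ∈ G.VA → σ.1 u = v) (hB : u ∉ G.VA → (u, v) ∈ G.E) :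
    ∃ τ' : G.BobStrategy, G.play σ τ' = Function.update (G.play σ τ) u v := by
  by_cases hu : u ∈ G.VA
  · refine ⟨τ, (Function.update_eq_self_iff.2 ?_).symm⟩
    simp [play, hu, hA hu]
  · refine ⟨⟨Function.update τ.1 u v, fun x hx => ?_⟩, ?_⟩
    · by_cases hxu : x = u
      · subst hxu
        simpa using hB hu
      · simpa [hxu] using τ.2 x hx
    · funext x
      by_cases hxu : x = u
      · subst hxu
        simp [play, hu]
      · simp [play, hxu]

theorem satLocal_iSup_stratEnergy (G : GameGraph V) (w : V → V → ℤ) (σ : G.AliceStrategy) :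
    SatLocal G w fun s => ⨆ τ : G.BobStrategy, stratEnergy w (G.play σ τ) s := by
  have key {u v : V} (hA : u ∈ G.VA → σ.1 u = v) (hB : u ∉ G.VA → (u, v) ∈ G.E) :
      toZInf (⨆ τ : G.BobStrategy, stratEnergy w (G.play σ τ) v) ≤
        toZInf (⨆ τ : G.BobStrategy, stratEnergy w (G.play σ τ) u) + (w u v : WithTop ℤ) := by
    rw [toZInf_le_add_iff]
    intro n hn
    have hu := hn.le
    simp only [iSup_le_iff, stratEnergy_le_iff] at hu
    have hv (τ : G.BobStrategy) (i : ℕ) :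
        -prefixWeight w (G.play σ τ) v i ≤ n + w u v := by
      obtain ⟨τ', hτ'⟩ := G.exists_play_eq_update σ τ hA hB
      exact neg_prefixWeight_le_add w _ u v n (hu τ) (hτ' ▸ hu τ') i
    have hnonneg : 0 ≤ n + w u v := by
      simpa [prefixWeight] using hv (Classical.arbitrary _) 0
    refine ⟨(n + w u v).toNat, ?_, (Int.toNat_of_nonneg hnonneg).le⟩
    simp only [iSup_le_iff, stratEnergy_le_iff, Int.toNat_of_nonneg hnonneg]
    exact hv
  exact ⟨fun u hu => ⟨σ.1 u, σ.2 u hu, key (fun _ => rfl) (absurd hu)⟩,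
    fun u hu v huv => key (fun h => absurd h hu) fun _ => huv⟩

theorem SatLocal.iInf {G : GameGraph V} {w : V → V → ℤ} {ι : Type*} [Nonempty ι]
    {e : ι → V → ℕ∞} (he : ∀ i, SatLocal G w (e i)) : SatLocal G w fun v => ⨅ i, e i v := by
  have key {u v : V} {i : ι} (hi : e i u = ⨅ i, e i u)
      (h : toZInf (e i v) ≤ toZInf (e i u) + (w u v : WithTop ℤ)) :
      toZInf (⨅ i, e i v) ≤ toZInf (⨅ i, e i u) + (w u v : WithTop ℤ) := by
    rw [toZInf_le_add_iff] at h ⊢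
    intro n hn
    obtain ⟨m, hm, hmn⟩ := h n (hi.trans hn)
    exact ⟨m, (iInf_le _ i).trans hm, hmn⟩
  constructor
  · intro u hu
    obtain ⟨i, hi⟩ := ciInf_mem fun i => e i u
    obtain ⟨v, huv, hv⟩ := (he i).1 u hu
    exact ⟨v, huv, key hi hv⟩
  · intro u hu v huv
    obtain ⟨i, hi⟩ := ciInf_mem fun i => e i u
    exact key hi ((he i).2 u hu v huv)

theorem satLocal_minEnergy (G : GameGraph V) (w : V → V → ℤ) :
    SatLocal G w (G.minEnergy w) :=
  SatLocal.iInf fun σ => G.satLocal_iSup_stratEnergy w σ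

theorem stratEnergy_le_of_forall_step {α : Type*} (w : α → α → ℤ) (f : α → α) (e : α → ℕ∞)
    (h : ∀ u, toZInf (e (f u)) ≤ toZInf (e u) + (w u (f u) : WithTop ℤ)) (s : α) :
    stratEnergy w f s ≤ e s := by
  have bound (i : ℕ) : ∀ s : α, ∀ n : ℕ, e s ≤ n → -prefixWeight w f s i ≤ n := by
    induction i with
    | zero => simp [prefixWeight]
    | succ i ih =>
      intro s n hn
      obtain ⟨k, hk⟩ := ENat.ne_top_iff_exists.1 (ne_top_of_le_ne_top (ENat.natCast_ne_top n) hn)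
      have hkn : k ≤ n := by rwa [← hk, Nat.cast_le] at hn
      obtain ⟨m, hm, hmk⟩ := (toZInf_le_add_iff _ _ _).1 (h s) k hk.symm
      have := ih (f s) m hm
      rw [add_comm, prefixWeight_add, prefixWeight_one, Function.iterate_one]
      omega
  rcases eq_or_ne (e s) ⊤ with hs | hs
  · simp [hs]
  · obtain ⟨n, hn⟩ := ENat.ne_top_iff_exists.1 hs
    rw [← hn, stratEnergy_le_iff]
    exact fun i => bound i s n hn.ge

theorem SatLocal.minEnergy_le {G : GameGraph V} {w : V → V → ℤ} {e : V → ℕ∞}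
    (he : SatLocal G w e) (s : V) : G.minEnergy w s ≤ e s := by
  classical
  obtain ⟨hA, hB⟩ := he
  choose! σ hσE hσ using hA
  refine (iInf_le _ (⟨σ, hσE⟩ : G.AliceStrategy)).trans (iSup_le fun τ => ?_)
  refine stratEnergy_le_of_forall_step w _ e (fun u => ?_) s
  by_cases hu : u ∈ G.VA
  · simpa only [play, hu, if_true] using hσ u hu
  · simpa only [play, hu, if_false] using hB u hu _ (τ.2 u hu)

/-- **Minimal Energy Characterization (Brim et al.).**
An energy function `e : V → ℕ∞` equals the minimal energy function `e*_{G,w}` iff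
(1) for every `u ∈ V_A` some edge `(u,v)` satisfies `e(u) + w(u,v) ≥ e(v)`,
(2) for every `u ∈ V_B` every edge `(u,v)` satisfies `e(u) + w(u,v) ≥ e(v)`, and
(3) `e` is pointwise below every energy function `e'` satisfying (1) and (2). -/
theorem minimal_energy_characterization (G : GameGraph V) (w : V → V → ℤ)
    (e : V → ℕ∞) :
    e = G.minEnergy w ↔
      (SatLocal G w e ∧
        ∀ e' : V → ℕ∞, SatLocal G w e' → ∀ v : V, e v ≤ e' v) := by
  constructor
  · rintro rfl
    exact ⟨G.satLocal_minEnergy w, fun e' he' => he'.minEnergy_le⟩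
  · rintro ⟨he, hmin⟩
    exact funext fun v => le_antisymm (hmin _ (G.satLocal_minEnergy w) v) (he.minEnergy_le v)

end GameGraph
end

section
/- Let (G,w) be an energy game, let B > 0 be an integer, let (σ,τ) be a pair of strategies, and let v be a node. If e*_{G(σ,τ),w}(v) = ∞ implies e*_{G(σ,τ),w_B}(v) = ∞, then e*_{G(σ,τ),w}(v) ≤ e*_{G(σ,τ),w_B}(v) + nB. -/
/-!
Common definitions for energy games (Brim et al. style), following the paper's
definitions: a game graph is a finite directed graph in which every node has
out-degree at least one, together with a partition of the nodes into Alice's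
nodes `VA` and Bob's nodes (the complement of `VA`).  Strategies are positional.
For a fixed pair of strategies the play from a node `s` is the orbit of the
induced successor function, and the minimal sufficient energy at `s` is the
least initial energy that keeps the running energy nonnegative forever, i.e.
`⨆ i, (-(weight of the length-i prefix))⁺ ∈ ℕ∞`; this coincides with
`∞` when the reachable cycle is negative and with `max (0, -min_P w(P))`
(minimum over simple paths `P` from `s`) otherwise.
-/

open scoped BigOperators

universe u

namespace GameGraph

variable {V : Type u} [Fintype V] [DecidableEq V]

theorem prefixWeight_succ {α : Type*} (w : α → α → ℤ) (f : α → α) (s : α) (i : ℕ) :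
    prefixWeight w f s (i + 1) = prefixWeight w f s i + w (f^[i] s) (f^[i + 1] s) :=
  Finset.sum_range_succ _ _

/-- Once the orbit has returned to an earlier node, shifting by the cycle length adds the
weight of the cycle. -/
theorem prefixWeight_add_period {α : Type*} (w : α → α → ℤ) (f : α → α) (s : α) {a L : ℕ}
    (h : f^[a + L] s = f^[a] s) (m : ℕ) :
    prefixWeight w f s (a + m + L) =
      prefixWeight w f s (a + m) + (prefixWeight w f s (a + L) - prefixWeight w f s a) := by
  have key : ∀ m, f^[a + m + L] s = f^[a + m] s := fun m => by
    rw [show a + m + L = m + (a + L) by omega, Function.iterate_add_apply, h,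
      ← Function.iterate_add_apply, add_comm m a]
  induction m with
  | zero => simp
  | succ m ih =>
    have e : a + (m + 1) + L = a + m + L + 1 := by omega
    have k := key (m + 1)
    rw [e] at k
    rw [e, prefixWeight_succ, ih, k, key m, ← add_assoc a m 1, prefixWeight_succ]
    ring

theorem prefixWeight_add_mul_period {α : Type*} (w : α → α → ℤ) (f : α → α) (s : α) {a L : ℕ}
    (h : f^[a + L] s = f^[a] s) (k : ℕ) :
    prefixWeight w f s (a + k * L) =
      prefixWeight w f s a + k * (prefixWeight w f s (a + L) - prefixWeight w f s a) := by
  induction k with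
  | zero => simp
  | succ k ih =>
    rw [Nat.succ_mul, ← add_assoc, prefixWeight_add_period w f s h, ih]
    push_cast
    ring

theorem neg_prefixWeight_le_of_stratEnergy_eq {α : Type*} {w : α → α → ℤ} {f : α → α} {s : α}
    {N : ℕ} (h : stratEnergy w f s = N) (i : ℕ) : -prefixWeight w f s i ≤ N := by
  have h1 : ((-(prefixWeight w f s i)).toNat : ℕ∞) ≤ N :=
    h ▸ le_iSup (fun i : ℕ => ((-(prefixWeight w f s i)).toNat : ℕ∞)) i
  have h2 : (-(prefixWeight w f s i)).toNat ≤ N := by exact_mod_cast h1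
  omega

/-- If the required energy is finite then every reachable cycle has nonnegative weight. -/
theorem prefixWeight_le_of_iterate_eq {α : Type*} {w : α → α → ℤ} {f : α → α} {s : α}
    (hfin : stratEnergy w f s ≠ ⊤) {a L : ℕ} (h : f^[a + L] s = f^[a] s) :
    prefixWeight w f s a ≤ prefixWeight w f s (a + L) := by
  obtain ⟨N, hN⟩ := ENat.ne_top_iff_exists.mp hfin
  by_contra! hlt
  set k : ℕ := N + 1 + (prefixWeight w f s a).toNat with hk
  have h1 := neg_prefixWeight_le_of_stratEnergy_eq hN.symm (a + k * L)
  rw [prefixWeight_add_mul_period w f s h] at h1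
  have h2 : (prefixWeight w f s (a + L) - prefixWeight w f s a) ≤ -1 := by omega
  have h3 := mul_le_mul_of_nonneg_left h2 (Int.natCast_nonneg k)
  omega

/-- If the required energy is finite, the minimum prefix weight is attained on a prefix
with fewer edges than there are nodes. -/
theorem exists_lt_card_prefixWeight_le {α : Type*} [Fintype α] {w : α → α → ℤ} {f : α → α} {s : α}
    (hfin : stratEnergy w f s ≠ ⊤) (i : ℕ) :
    ∃ j < Fintype.card α, prefixWeight w f s j ≤ prefixWeight w f s i := by
  induction i using Nat.strong_induction_on with
  | _ i ih =>
    by_cases hi : i < Fintype.card α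
    · exact ⟨i, hi, le_rfl⟩
    obtain ⟨x, y, hne, hxy⟩ := Fintype.exists_ne_map_eq_of_card_lt
      (fun k : Fin (Fintype.card α + 1) => f^[k.1] s) (by simp)
    obtain ⟨a, L, hL, haL, h⟩ : ∃ a L : ℕ, 0 < L ∧ a + L ≤ i ∧ f^[a + L] s = f^[a] s := by
      have hx := x.2
      have hy := y.2
      rcases lt_or_gt_of_ne (Fin.val_ne_of_ne hne) with hlt | hlt
      · refine ⟨x, y - x, by omega, by omega, ?_⟩
        rw [Nat.add_sub_cancel' hlt.le]
        exact hxy.symm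
      · refine ⟨y, x - y, by omega, by omega, ?_⟩
        rw [Nat.add_sub_cancel' hlt.le]
        exact hxy
    obtain ⟨m, rfl⟩ : ∃ m, i = a + m + L := ⟨i - a - L, by omega⟩
    obtain ⟨j, hj, hle⟩ := ih (a + m) (by omega)
    refine ⟨j, hj, hle.trans ?_⟩
    rw [prefixWeight_add_period w f s h]
    have := prefixWeight_le_of_iterate_eq hfin h
    omega

theorem roundW_le_add {α : Type*} (w : α → α → ℤ) {B : ℤ} (hB : 0 < B) (u v : α) :
    roundW w B u v ≤ w u v + B := by
  have hB' : (0 : ℚ) < B := by exact_mod_cast hB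
  have h := mul_le_mul_of_nonneg_right (Int.ceil_lt_add_one ((w u v : ℚ) / B)).le hB'.le
  rw [add_mul, div_mul_cancel₀ _ hB'.ne', one_mul] at h
  unfold roundW
  exact_mod_cast h

theorem prefixWeight_roundW_le {α : Type*} (w : α → α → ℤ) {B : ℤ} (hB : 0 < B) (f : α → α)
    (s : α) (i : ℕ) : prefixWeight (roundW w B) f s i ≤ prefixWeight w f s i + i * B := by
  induction i with
  | zero => simp [prefixWeight]
  | succ i ih =>
    rw [prefixWeight_succ, prefixWeight_succ]
    have := roundW_le_add w hB (f^[i] s) (f^[i + 1] s)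
    push_cast
    linarith

/-- For a fixed pair of strategies `(σ,τ)`, an integer `B > 0` and a node `v`:
if `e*_{G(σ,τ),w}(v) = ∞` implies `e*_{G(σ,τ),w_B}(v) = ∞` (where
`w_B(u,v) = ⌈w(u,v)/B⌉·B`), then
`e*_{G(σ,τ),w}(v) ≤ e*_{G(σ,τ),w_B}(v) + nB`. -/
theorem stratEnergy_le_rounded_add (G : GameGraph V) (w : V → V → ℤ)
    (B : ℤ) (hB : 0 < B)
    (σ : G.AliceStrategy) (τ : G.BobStrategy) (v : V)
    (h : stratEnergy w (G.play σ τ) v = ⊤ →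
      stratEnergy (roundW w B) (G.play σ τ) v = ⊤) :
    stratEnergy w (G.play σ τ) v ≤
      stratEnergy (roundW w B) (G.play σ τ) v +
        ((Fintype.card V * B.toNat : ℕ) : ℕ∞) := by
  by_cases hfin : stratEnergy w (G.play σ τ) v = ⊤
  · simp [h hfin]
  refine iSup_le fun i => ?_
  obtain ⟨j, hj, hle⟩ := exists_lt_card_prefixWeight_le hfin i
  refine le_trans ?_ (add_le_add_left (le_iSup (fun i : ℕ =>
    ((-(prefixWeight (roundW w B) (G.play σ τ) v i)).toNat : ℕ∞)) j) _)
  norm_cast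
  have h1 := prefixWeight_roundW_le w hB (G.play σ τ) v j
  have h2 : (j : ℤ) * B ≤ Fintype.card V * B := by gcongr
  have h3 : ((Fintype.card V * B.toNat : ℕ) : ℤ) = Fintype.card V * B := by
    rw [Nat.cast_mul, Int.toNat_of_nonneg hB.le]
  omega

end GameGraph
end

section
/- Let (G,w) be an energy game and let B > 0 be an integer. If C is a cycle in G whose average weight under w is at most −B, i.e. (Σ_{(u,v) ∈ C} w(u,v)) / |C| ≤ −B, then C is a negative cycle under the rounded weights w_B, i.e. Σ_{(u,v) ∈ C} w_B(u,v) < 0. -/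
/-!
Common definitions for energy games (Brim et al. style), following the paper's
definitions: a game graph is a finite directed graph in which every node has
out-degree at least one, together with a partition of the nodes into Alice's
nodes `VA` and Bob's nodes (the complement of `VA`).  Strategies are positional.
For a fixed pair of strategies the play from a node `s` is the orbit of the
induced successor function, and the minimal sufficient energy at `s` is the
least initial energy that keeps the running energy nonnegative forever, i.e.
`⨆ i, (-(weight of the length-i prefix))⁺ ∈ ℕ∞`; this coincides with
`∞` when the reachable cycle is negative and with `max (0, -min_P w(P))`
(minimum over simple paths `P` from `s`) otherwise.
-/

open scoped BigOperators

universe u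

namespace GameGraph

variable {V : Type u} [Fintype V] [DecidableEq V]

theorem roundW_lt (w : V → V → ℤ) {B : ℤ} (hB : 0 < B) (u v : V) :
    roundW w B u v < w u v + B := by
  have hBq : (0 : ℚ) < B := by exact_mod_cast hB
  have h := mul_lt_mul_of_pos_right (Int.ceil_lt_add_one ((w u v : ℚ) / B)) hBq
  rw [add_mul, div_mul_cancel₀ _ hBq.ne', one_mul] at h
  unfold roundW
  exact_mod_cast h

/-- Rounding raises the total weight of a nonempty list of edges by less than `B` per edge. -/
theorem sum_roundW_lt (w : V → V → ℤ) {B : ℤ} (hB : 0 < B) {l : List (V × V)} (hl : l ≠ []) :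
    (l.map fun p => roundW w B p.1 p.2).sum <
      (l.map fun p => w p.1 p.2).sum + l.length * B := by
  have h := List.sum_lt_sum_of_ne_nil hl (fun p : V × V => roundW w B p.1 p.2)
    (fun p => w p.1 p.2 + B) fun p _ => roundW_lt w hB p.1 p.2
  simpa [List.sum_map_add] using h

/-- If a cycle `C` in `(G,w)` (a closed directed walk on distinct nodes, given by the
list of its nodes, with edge set `c.zip (c.rotate 1)`) has average weight at most `-B`
for an integer `B > 0`, then `C` is a negative cycle under the rounded weights
`w_B(u,v) = ⌈w(u,v)/B⌉·B`. -/
theorem rounded_cycle_negative (G : GameGraph V) (w : V → V → ℤ)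
    (B : ℤ) (hB : 0 < B)
    (c : List V) (hne : c ≠ []) (hnd : c.Nodup)
    (hedges : ∀ p ∈ c.zip (c.rotate 1), p ∈ G.E)
    (havg : ((((c.zip (c.rotate 1)).map (fun p => w p.1 p.2)).sum : ℤ) : ℚ) /
        (c.length : ℚ) ≤ -(B : ℚ)) :
    (((c.zip (c.rotate 1)).map (fun p => roundW w B p.1 p.2)).sum : ℤ) < 0 := by
  have hlen : (c.zip (c.rotate 1)).length = c.length := by simp
  have hpos : 0 < c.length := List.length_pos_iff.mpr hne
  have hzip : c.zip (c.rotate 1) ≠ [] := by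
    rwa [← List.length_pos_iff, hlen]
  have h := sum_roundW_lt w hB hzip
  rw [hlen] at h
  rw [div_le_iff₀ (by exact_mod_cast hpos)] at havg
  have hsum : ((c.zip (c.rotate 1)).map (fun p => w p.1 p.2)).sum ≤ -B * c.length := by
    exact_mod_cast havg
  linarith

end GameGraph
end

section
/- Every complete bipartite game graph is strongly ergodic, i.e., every induced subgraph in which every node has out-degree at least 1 has no non-trivial ergodic partition. -/
/-- **Complete bipartite game graphs are strongly ergodic.**
A game graph is given by a finite edge set `E` on nodes `V` and the set `VA` of
Alice's nodes (Bob owns the complement).  Suppose it is complete bipartite: every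
edge joins a node of Alice and a node of Bob (`hbip`), and for every node `u` of
Alice and node `v` of Bob both edges `(u,v)` and `(v,u)` are present (`hcomp`).
Then for every induced subgraph (on a node set `U`) in which every node has
out-degree at least `1`, there is no non-trivial ergodic partition `(SA, SB)` of `U`:
it cannot happen that `SA` and `SB` are both nonempty while
(1) every Alice node of `SA` has an edge staying in `SA`,
(2) no Bob node of `SA` has an edge into `SB`,
(3) every Bob node of `SB` has an edge staying in `SB`, and
(4) no Alice node of `SB` has an edge into `SA`. -/
theorem complete_bipartite_strongly_ergodic {V : Type*} [DecidableEq V]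
    (E : Finset (V × V)) (VA : Finset V)
    (hbip : ∀ p ∈ E, (p.1 ∈ VA ↔ p.2 ∉ VA))
    (hcomp : ∀ u v : V, u ∈ VA → v ∉ VA → ((u, v) ∈ E ∧ (v, u) ∈ E)) :
    ∀ U : Finset V, (∀ u ∈ U, ∃ v ∈ U, (u, v) ∈ E) →
      ∀ SA SB : Finset V, SA ∪ SB = U → Disjoint SA SB →
        ¬(SA.Nonempty ∧ SB.Nonempty ∧
          (∀ u ∈ SA, u ∈ VA → ∃ v ∈ SA, (u, v) ∈ E) ∧
          (∀ u ∈ SA, u ∉ VA → ∀ v ∈ SB, (u, v) ∉ E) ∧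
          (∀ u ∈ SB, u ∉ VA → ∃ v ∈ SB, (u, v) ∈ E) ∧
          (∀ u ∈ SB, u ∈ VA → ∀ v ∈ SA, (u, v) ∉ E)) := by
  rintro U - SA SB - - ⟨⟨x, hx⟩, ⟨y, hy⟩, hA, hAB, hB, -⟩
  obtain ⟨b, hb, hbA⟩ : ∃ b ∈ SA, b ∉ VA := by
    by_cases h : x ∈ VA
    · obtain ⟨v, hv, he⟩ := hA x hx h
      exact ⟨v, hv, (hbip _ he).mp h⟩
    · exact ⟨x, hx, h⟩
  obtain ⟨a, ha, haA⟩ : ∃ a ∈ SB, a ∈ VA := by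
    by_cases h : y ∈ VA
    · exact ⟨y, hy, h⟩
    · obtain ⟨v, hv, he⟩ := hB y hy h
      exact ⟨v, hv, not_not.mp (mt (hbip _ he).mpr h)⟩
  exact hAB b hb hbA a ha (hcomp a b haA hbA).2
end
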